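/- Every simple graph G that has no isolated edge and at most one isolated vertex has an irreducible proper distinguishing edge colouring, i.e., there exist a type C and a proper distinguishing edge colouring c : E(G) → C such that no nontrivial merge of two colours of c is a proper distinguishing edge colouring. -/

import Mathlib

universe u w

/-- An edge colouring `c` is distinguishing if the identity is the only
automorphism of `G` preserving `c` (where an automorphism `φ` maps an edge
`{u, v}` to the edge `{φ u, φ v}`). -/
def EdgeDistinguishing {V : Type u} {C : Type w} (G : SimpleGraph V) (c : G.edgeSet → C) : Prop :=
  ∀ φ : G ≃g G, (∀ e : G.edgeSet, c (φ.mapEdgeSet e) = c e) → ∀ x : V, φ x = x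

/-- An edge colouring is proper if distinct edges sharing a common endpoint
receive distinct colours. -/
def ProperEdgeColoring {V : Type u} {C : Type w} (G : SimpleGraph V) (c : G.edgeSet → C) : Prop :=
  ∀ e f : G.edgeSet, e ≠ f → (∃ x : V, x ∈ (e : Sym2 V) ∧ x ∈ (f : Sym2 V)) → c e ≠ c f

/-- A vertex is isolated if it has no neighbours. -/
def IsolatedVertex {V : Type u} (G : SimpleGraph V) (v : V) : Prop :=
  ∀ u : V, ¬ G.Adj v u

/-- The pair `u, v` forms an isolated edge: `u` and `v` are adjacent and each of
them has no neighbour other than the other one. -/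
def IsolatedEdge {V : Type u} (G : SimpleGraph V) (u v : V) : Prop :=
  G.Adj u v ∧ (∀ w : V, G.Adj u w → w = v) ∧ (∀ w : V, G.Adj v w → w = u)

open Classical in
/-- The map merging colour `b` into colour `a`. -/
noncomputable def mergeMap {C : Type w} (a b : C) : C → C :=
  fun x => if x = b then a else x

namespace SimpleGraph

variable {V : Type u} {G : SimpleGraph V}

/-- A setoid on the edges is proper if distinct incident edges are never related. -/
def ProperSetoid (R : Setoid G.edgeSet) : Prop :=
  ∀ {a b d : V} (hb : G.Adj a b) (hd : G.Adj a d), R ⟨s(a, b), hb⟩ ⟨s(a, d), hd⟩ → b = d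

/-- A setoid on the edges is distinguishing if every automorphism preserving all its classes is
trivial. -/
def DistinguishingSetoid (R : Setoid G.edgeSet) : Prop :=
  ∀ φ : G ≃g G, (∀ e, R (φ.mapEdgeSet e) e) → ∀ x, φ x = x

theorem properEdgeColoring_iff_properSetoid {C : Type*} (c : G.edgeSet → C) :
    ProperEdgeColoring G c ↔ ProperSetoid (Setoid.ker c) := by
  constructor
  · intro h a b d hb hd hR
    by_contra hne
    exact h ⟨s(a, b), hb⟩ ⟨s(a, d), hd⟩
      (fun heq => hne (Sym2.congr_right.1 (congrArg Subtype.val heq))) ⟨a, by simp, by simp⟩ hR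
  · rintro h ⟨e, he⟩ ⟨f, hf⟩ hne ⟨x, hxe, hxf⟩ hc
    obtain ⟨b, rfl⟩ := hxe
    obtain ⟨d, rfl⟩ := hxf
    obtain rfl := h he hf hc
    exact hne rfl

theorem ProperSetoid.mono {R S : Setoid G.edgeSet} (h : R ≤ S) (hS : ProperSetoid S) :
    ProperSetoid R :=
  fun hb hd hR => hS hb hd (h hR)

theorem DistinguishingSetoid.mono {R S : Setoid G.edgeSet} (h : R ≤ S)
    (hS : DistinguishingSetoid S) : DistinguishingSetoid R :=
  fun φ hφ => hS φ fun e => h (hφ e)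

/-- A proper distinguishing setoid that is maximal yields an irreducible colouring. -/
theorem exists_irreducible_of_maximal {R : Setoid G.edgeSet}
    (hR : Maximal (fun S => ProperSetoid S ∧ DistinguishingSetoid S) R) :
    ∃ (C : Type u) (c : G.edgeSet → C),
      ProperEdgeColoring G c ∧ EdgeDistinguishing G c ∧
        ∀ a b : C, a ≠ b → b ∈ Set.range c →
          ¬ (ProperEdgeColoring G (mergeMap a b ∘ c) ∧
              EdgeDistinguishing G (mergeMap a b ∘ c)) := by
  have hker : Setoid.ker (Quotient.mk R) = R := Setoid.ker_mk_eq R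
  refine ⟨Quotient R, Quotient.mk R, ?_, ?_, ?_⟩
  · rw [properEdgeColoring_iff_properSetoid, hker]
    exact hR.1.1
  · exact fun φ hφ => hR.1.2 φ fun e => Quotient.exact (hφ e)
  · rintro a b hab - ⟨hp, hd⟩
    rw [properEdgeColoring_iff_properSetoid] at hp
    have hle : R ≤ Setoid.ker (mergeMap a b ∘ Quotient.mk R) := fun x y h =>
      congrArg (mergeMap a b) (Quotient.sound h)
    have hle' := hR.2 ⟨hp, hd⟩ hle
    obtain ⟨x, rfl⟩ := Quotient.exists_rep a
    obtain ⟨y, rfl⟩ := Quotient.exists_rep b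
    refine hab (Quotient.sound (hle' ?_))
    simp [Setoid.ker_def, mergeMap]

/-- The property that `S` is a union of classes of `R`. -/
def SaturatedFor {α : Type*} (S : Set α) (R : Setoid α) : Prop :=
  ∀ x y, R x y → x ∈ S → y ∈ S

theorem SaturatedFor.mono {α : Type*} {S : Set α} {R T : Setoid α} (h : R ≤ T)
    (hT : SaturatedFor S T) : SaturatedFor S R :=
  fun x y hxy => hT x y (h hxy)

/-- If a setoid is maximal among those satisfying an order-convex property and having the single
class `S` as a union of classes, then some coarser setoid is maximal for the property alone. -/
theorem exists_maximal_of_maximal_saturated {α : Type*} {P : Setoid α → Prop}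
    (hP : ∀ {R S T}, P R → R ≤ S → S ≤ T → P T → P S) {S : Set α} {R : Setoid α}
    (hR : Maximal (fun T => P T ∧ SaturatedFor S T) R) (hS : ∀ x ∈ S, ∀ y ∈ S, R x y) :
    ∃ T, R ≤ T ∧ Maximal P T := by
  by_cases hmax : Maximal P R
  · exact ⟨R, le_rfl, hmax⟩
  have outside : ∀ {T : Setoid α}, P T → R ≤ T → ∀ {x y}, x ∉ S → y ∉ S → T x y → R x y := by
    intro T hT hRT x y hx hy hxy
    let T' : Setoid α := T ⊓ Setoid.ker (· ∈ S)
    have hRT' : R ≤ T' := fun x y h =>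
      ⟨hRT h, propext ⟨hR.1.2 x y h, hR.1.2 y x (R.symm' h)⟩⟩
    refine hR.2 (y := T') ⟨hP hR.1.1 hRT' inf_le_left hT, ?_⟩ hRT' ⟨hxy, ?_⟩
    · intro x y h hx
      exact (show (x ∈ S) = (y ∈ S) from h.2) ▸ hx
    · exact propext ⟨fun h => (hx h).elim, fun h => (hy h).elim⟩
  obtain ⟨T, hT, hRT, hTR⟩ : ∃ T, P T ∧ R ≤ T ∧ ¬ T ≤ R := by
    by_contra! h
    exact hmax ⟨hR.1.1, fun T hT hRT => h T hT hRT⟩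
  have hsat : ¬ SaturatedFor S T := fun h => hTR (hR.2 ⟨hT, h⟩ hRT)
  obtain ⟨s, s', hss', hs, hs'⟩ : ∃ s s', T s s' ∧ s ∈ S ∧ s' ∉ S := by
    simpa [SaturatedFor] using hsat
  have move : ∀ x, ∃ x', x' ∉ S ∧ T x x' := by
    intro x
    by_cases hx : x ∈ S
    · exact ⟨s', hs', T.trans' (hRT (hS x hx s hs)) hss'⟩
    · exact ⟨x, hx, T.refl' x⟩
  refine ⟨T, hRT, hT, fun T' hT' hTT' x y hxy => ?_⟩
  obtain ⟨x', hx', hxx'⟩ := move x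
  obtain ⟨y', hy', hyy'⟩ := move y
  have := outside hT' (hRT.trans hTT') hx' hy'
    (T'.trans' (T'.symm' (hTT' hxx')) (T'.trans' hxy (hTT' hyy')))
  exact T.trans' hxx' (T.trans' (hRT this) (T.symm' hyy'))

/-- Zorn's lemma for setoids: a family closed under unions of nonempty chains has a maximal
member. -/
theorem exists_maximal_setoid {α : Type*} {P : Setoid α → Prop} {R₀ : Setoid α} (h₀ : P R₀)
    (hP : ∀ (c : Set (Setoid α)) (U : Setoid α), c.Nonempty → IsChain (· ≤ ·) c →
      (∀ R ∈ c, P R) → (∀ x y, U x y ↔ ∃ R ∈ c, R x y) → P U) :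
    ∃ R, Maximal P R := by
  obtain ⟨m, -, hm⟩ := zorn_le_nonempty₀ {R | P R} (fun c hc hchain y hy => by
    let U : Setoid α :=
      { r := fun a b => ∃ R ∈ c, R a b
        iseqv := by
          refine ⟨fun a => ⟨y, hy, y.refl' a⟩, ?_, ?_⟩
          · rintro a b ⟨R, hR, h⟩
            exact ⟨R, hR, R.symm' h⟩
          · rintro a b d ⟨R, hR, h⟩ ⟨S, hS, h'⟩
            rcases hchain.total hR hS with hle | hle
            · exact ⟨S, hS, S.trans' (hle h) h'⟩
            · exact ⟨R, hR, R.trans' h (hle h')⟩ }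
    exact ⟨U, hP c U ⟨y, hy⟩ hchain hc fun _ _ => Iff.rfl, fun R hR a b h => ⟨R, hR, h⟩⟩) R₀ h₀
  exact ⟨m, hm⟩

/-- A simultaneous identification of isomorphic components: `fold` maps each component
isomorphically onto the representative of its isomorphism type. -/
structure ComponentFolding (G : SimpleGraph V) where
  /-- The map to the representative components. -/
  fold : V → V
  /-- The representative of the isomorphism type of a component. -/
  type : G.ConnectedComponent → G.ConnectedComponent
  fold_inj : ∀ {x y}, G.connectedComponentMk x = G.connectedComponentMk y →
    fold x = fold y → x = y
  fold_adj : ∀ {x y}, G.Adj x y → G.Adj (fold x) (fold y)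
  adj_of_fold : ∀ {x y}, G.connectedComponentMk x = G.connectedComponentMk y →
    G.Adj (fold x) (fold y) → G.Adj x y
  mk_fold : ∀ x, G.connectedComponentMk (fold x) = type (G.connectedComponentMk x)
  type_iso : ∀ (φ : G ≃g G) (x),
    type (G.connectedComponentMk (φ x)) = type (G.connectedComponentMk x)
  exists_fold : ∀ {c z}, G.connectedComponentMk z = type c →
    ∃ y, G.connectedComponentMk y = c ∧ fold y = z

theorem nonempty_componentFolding (G : SimpleGraph V) : Nonempty (ComponentFolding G) := by
  let r : Setoid G.ConnectedComponent :=
    { r := fun c d => Nonempty (c.toSimpleGraph ≃g d.toSimpleGraph)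
      iseqv := ⟨fun _ => ⟨Iso.refl⟩, fun ⟨ψ⟩ => ⟨ψ.symm⟩, fun ⟨ψ⟩ ⟨χ⟩ => ⟨χ.comp ψ⟩⟩ }
  let type : G.ConnectedComponent → G.ConnectedComponent := fun c => (Quotient.mk r c).out
  have hψ : ∀ c, Nonempty (c.toSimpleGraph ≃g (type c).toSimpleGraph) := fun c =>
    r.symm' (Quotient.mk_out (s := r) c)
  let ψ := fun c => (hψ c).some
  have hfold : ∀ {c x} (hx : G.connectedComponentMk x = c),
      (ψ (G.connectedComponentMk x) ⟨x, rfl⟩).1 = (ψ c ⟨x, hx⟩).1 := by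
    rintro _ x rfl
    rfl
  refine ⟨⟨fun x => (ψ (G.connectedComponentMk x) ⟨x, rfl⟩).1, type, ?_, ?_, ?_, ?_, ?_, ?_⟩⟩
  · intro x y hxy h
    rw [hfold hxy] at h
    exact congrArg Subtype.val ((ψ _).injective (Subtype.ext h))
  · intro x y h
    have hxy : G.connectedComponentMk x = G.connectedComponentMk y :=
      ConnectedComponent.sound h.reachable
    rw [hfold hxy]
    exact (ψ (G.connectedComponentMk y)).map_adj_iff.2
      (show (G.connectedComponentMk y).toSimpleGraph.Adj ⟨x, hxy⟩ ⟨y, rfl⟩ from h)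
  · intro x y hxy h
    rw [hfold hxy] at h
    exact (ψ (G.connectedComponentMk y)).map_adj_iff.1 h
  · exact fun x => (ψ (G.connectedComponentMk x) ⟨x, rfl⟩).2
  · intro φ x
    have : r (G.connectedComponentMk (φ x)) (G.connectedComponentMk x) :=
      r.symm' ⟨(ConnectedComponent.isoEquivSupp φ (G.connectedComponentMk x)), by
        intro a b
        exact φ.map_adj_iff⟩
    exact congrArg Quotient.out (Quotient.sound this)
  · intro c z hz
    obtain ⟨⟨y, hy⟩, h⟩ := (ψ c).surjective ⟨z, hz⟩
    exact ⟨y, hy, by rw [hfold hy, h]⟩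

/-- The set of edges joining `f c` to `g c`, where `c` runs over the components in `D`. -/
def edgeFamily (D : Set G.ConnectedComponent) (f g : G.ConnectedComponent → V) :
    Set G.edgeSet :=
  {e | ∃ c ∈ D, e.1 = s(f c, g c)}

/-- The map `f` picks a vertex in every component belonging to `D`. -/
def PicksFrom (D : Set G.ConnectedComponent) (f : G.ConnectedComponent → V) : Prop :=
  ∀ c ∈ D, G.connectedComponentMk (f c) = c

theorem mk_eq_of_mem_edgeFamily {D : Set G.ConnectedComponent} {f g : G.ConnectedComponent → V}
    (hf : PicksFrom D f) (hg : PicksFrom D g) {a b : V} {hab : G.Adj a b}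
    (h : ⟨s(a, b), hab⟩ ∈ edgeFamily D f g) :
    G.connectedComponentMk a ∈ D ∧
      s(a, b) = s(f (G.connectedComponentMk a), g (G.connectedComponentMk a)) := by
  obtain ⟨c, hc, heq⟩ := h
  have hac : G.connectedComponentMk a = c := by
    rcases Sym2.eq_iff.1 heq with ⟨h1, -⟩ | ⟨h1, -⟩ <;> subst h1
    exacts [hf c hc, hg c hc]
  subst hac
  exact ⟨hc, heq⟩

theorem connectedComponentMk_eq_of_adj {a b : V} (h : G.Adj a b) :
    G.connectedComponentMk a = G.connectedComponentMk b :=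
  ConnectedComponent.sound h.reachable

namespace ComponentFolding

variable (Φ : ComponentFolding G)

theorem edge_inj {a b c d : V} (hab : G.Adj a b) (hcd : G.Adj c d)
    (hac : G.connectedComponentMk a = G.connectedComponentMk c)
    (h : s(Φ.fold a, Φ.fold b) = s(Φ.fold c, Φ.fold d)) : s(a, b) = s(c, d) := by
  have hab' := connectedComponentMk_eq_of_adj hab
  have hcd' := connectedComponentMk_eq_of_adj hcd
  rcases Sym2.eq_iff.1 h with ⟨h1, h2⟩ | ⟨h1, h2⟩
  · rw [Φ.fold_inj hac h1, Φ.fold_inj (hab'.symm.trans (hac.trans hcd')) h2]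
  · rw [Φ.fold_inj (hac.trans hcd') h1, Φ.fold_inj (hab'.symm.trans hac) h2, Sym2.eq_swap]

/-- The map `f` picks corresponding vertices in isomorphic components belonging to `D`. -/
def Consistent (D : Set G.ConnectedComponent) (f : G.ConnectedComponent → V) : Prop :=
  ∀ c ∈ D, ∀ d ∈ D, Φ.type c = Φ.type d → Φ.fold (f c) = Φ.fold (f d)

variable {Φ}

theorem mem_edgeFamily_of_fold_eq {D : Set G.ConnectedComponent}
    {f g : G.ConnectedComponent → V} (hD : ∀ c ∈ D, ∀ d, (∃ x y, G.Adj x y ∧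
      G.connectedComponentMk x = d) → Φ.type c = Φ.type d → d ∈ D)
    (hf : PicksFrom D f) (hg : PicksFrom D g) (hadj : ∀ c ∈ D, G.Adj (f c) (g c))
    (hf' : Φ.Consistent D f) (hg' : Φ.Consistent D g) {x y : G.edgeSet}
    (hx : x ∈ edgeFamily D f g) (h : x.1.map Φ.fold = y.1.map Φ.fold) :
    y ∈ edgeFamily D f g := by
  obtain ⟨⟨a, b⟩, hab⟩ := x
  obtain ⟨⟨c, d⟩, hcd⟩ := y
  change G.Adj a b at hab
  change G.Adj c d at hcd
  change s(Φ.fold a, Φ.fold b) = s(Φ.fold c, Φ.fold d) at h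
  obtain ⟨haD, hab_eq⟩ := mk_eq_of_mem_edgeFamily hf hg hx
  have htype : Φ.type (G.connectedComponentMk a) = Φ.type (G.connectedComponentMk c) := by
    rw [← Φ.mk_fold, ← Φ.mk_fold]
    rcases Sym2.eq_iff.1 h with ⟨h1, -⟩ | ⟨h1, -⟩
    · rw [h1]
    · rw [h1, connectedComponentMk_eq_of_adj (Φ.fold_adj hcd)]
  have hcD := hD _ haD _ ⟨c, d, hcd, rfl⟩ htype
  refine ⟨_, hcD, Φ.edge_inj hcd (hadj _ hcD) (hf _ hcD).symm ?_⟩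
  rw [← h, ← hf' _ haD _ hcD htype, ← hg' _ haD _ hcD htype]
  exact congrArg (Sym2.map Φ.fold) hab_eq

end ComponentFolding

/-- The components having an edge. -/
def nontrivialComponents (G : SimpleGraph V) : Set G.ConnectedComponent :=
  {c | ∃ x y, G.Adj x y ∧ G.connectedComponentMk x = c}

/-- A choice, consistent along a component folding, of a vertex `u c` in each nontrivial component
`c`, of two neighbours `p c`, `q c` of it and of a neighbour `t c` of `p c`, with `t c = u c` only
if `p c` is a leaf. -/
structure Anchoring (G : SimpleGraph V) extends ComponentFolding G where
  /-- The anchor vertex. -/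
  u : G.ConnectedComponent → V
  /-- A neighbour of the anchor vertex. -/
  p : G.ConnectedComponent → V
  /-- Another neighbour of the anchor vertex. -/
  q : G.ConnectedComponent → V
  /-- A neighbour of `p`. -/
  t : G.ConnectedComponent → V
  mk_u : PicksFrom G.nontrivialComponents u
  adj_u_p : ∀ c ∈ G.nontrivialComponents, G.Adj (u c) (p c)
  adj_u_q : ∀ c ∈ G.nontrivialComponents, G.Adj (u c) (q c)
  p_ne_q : ∀ c ∈ G.nontrivialComponents, p c ≠ q c
  adj_p_t : ∀ c ∈ G.nontrivialComponents, G.Adj (p c) (t c)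
  leaf : ∀ c ∈ G.nontrivialComponents, t c = u c → ∀ s, G.Adj (p c) s → s = u c
  fold_u : toComponentFolding.Consistent G.nontrivialComponents u
  fold_p : toComponentFolding.Consistent G.nontrivialComponents p
  fold_q : toComponentFolding.Consistent G.nontrivialComponents q
  fold_t : toComponentFolding.Consistent G.nontrivialComponents t

theorem nonempty_anchoring (hedge : ∀ u v : V, ¬ IsolatedEdge G u v) :
    Nonempty (Anchoring G) := by
  obtain ⟨Φ⟩ := nonempty_componentFolding G
  have key : ∀ c, ∃ u p q t, c ∈ G.nontrivialComponents →
      G.connectedComponentMk u = c ∧ G.Adj u p ∧ G.Adj u q ∧ p ≠ q ∧ G.Adj p t ∧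
        (t = u → ∀ s, G.Adj p s → s = u) := by
    intro c
    by_cases hc : c ∈ G.nontrivialComponents
    · obtain ⟨x, y, hxy, rfl⟩ := hc
      obtain ⟨u, p, q, hu, hp, hq, hpq⟩ : ∃ u p q,
          G.connectedComponentMk u = G.connectedComponentMk x ∧
            G.Adj u p ∧ G.Adj u q ∧ p ≠ q := by
        have := hedge x y
        simp only [IsolatedEdge, hxy, true_and, not_and_or, not_forall] at this
        rcases this with ⟨w, hw, hne⟩ | ⟨w, hw, hne⟩
        · exact ⟨x, y, w, rfl, hxy, hw, fun h => hne h.symm⟩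
        · exact ⟨y, x, w, (connectedComponentMk_eq_of_adj hxy).symm, hxy.symm, hw,
            fun h => hne h.symm⟩
      by_cases hs : ∀ s, G.Adj p s → s = u
      · exact ⟨u, p, q, u, fun _ => ⟨hu, hp, hq, hpq, hp.symm, fun _ => hs⟩⟩
      · push Not at hs
        obtain ⟨s, hs, hne⟩ := hs
        exact ⟨u, p, q, s, fun _ => ⟨hu, hp, hq, hpq, hs, fun h => (hne h).elim⟩⟩
    · obtain ⟨x, -⟩ := c.exists_rep
      exact ⟨x, x, x, x, fun h => (hc h).elim⟩
  choose U P Q T hUPQT using key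
  have lift : ∀ c, ∃ u p q t, c ∈ G.nontrivialComponents →
      G.connectedComponentMk u = c ∧ G.Adj u p ∧ G.Adj u q ∧ p ≠ q ∧ G.Adj p t ∧
        (t = u → ∀ s, G.Adj p s → s = u) ∧ Φ.fold u = U (Φ.type c) ∧
        Φ.fold p = P (Φ.type c) ∧ Φ.fold q = Q (Φ.type c) ∧ Φ.fold t = T (Φ.type c) := by
    intro c
    by_cases hc : c ∈ G.nontrivialComponents
    · have hc' : Φ.type c ∈ G.nontrivialComponents := by
        obtain ⟨x, y, hxy, rfl⟩ := hc
        exact ⟨_, _, Φ.fold_adj hxy, Φ.mk_fold x⟩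
      obtain ⟨hU, hP, hQ, hPQ, hT, hleaf⟩ := hUPQT _ hc'
      obtain ⟨u, huc, hu⟩ := Φ.exists_fold hU
      obtain ⟨p, hpc, hp⟩ := Φ.exists_fold ((connectedComponentMk_eq_of_adj hP).symm.trans hU)
      obtain ⟨q, hqc, hq⟩ := Φ.exists_fold ((connectedComponentMk_eq_of_adj hQ).symm.trans hU)
      obtain ⟨t, htc, ht⟩ := Φ.exists_fold ((connectedComponentMk_eq_of_adj hT).symm.trans
        ((connectedComponentMk_eq_of_adj hP).symm.trans hU))
      refine ⟨u, p, q, t, fun _ => ⟨huc, ?_, ?_, ?_, ?_, ?_, hu, hp, hq, ht⟩⟩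
      · exact Φ.adj_of_fold (huc.trans hpc.symm) (by rwa [hu, hp])
      · exact Φ.adj_of_fold (huc.trans hqc.symm) (by rwa [hu, hq])
      · rintro rfl
        exact hPQ (hp.symm.trans hq)
      · exact Φ.adj_of_fold (hpc.trans htc.symm) (by rwa [hp, ht])
      · rintro rfl s hs
        refine Φ.fold_inj (((connectedComponentMk_eq_of_adj hs).symm.trans hpc).trans huc.symm) ?_
        rw [hu]
        exact hleaf (ht.symm.trans hu) _ (hp ▸ Φ.fold_adj hs)
    · obtain ⟨x, -⟩ := c.exists_rep
      exact ⟨x, x, x, x, fun h => (hc h).elim⟩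
  choose u p q t h using lift
  refine ⟨{ Φ with
    u := u
    p := p
    q := q
    t := t
    mk_u := fun c hc => (h c hc).1
    adj_u_p := fun c hc => (h c hc).2.1
    adj_u_q := fun c hc => (h c hc).2.2.1
    p_ne_q := fun c hc => (h c hc).2.2.2.1
    adj_p_t := fun c hc => (h c hc).2.2.2.2.1
    leaf := fun c hc => (h c hc).2.2.2.2.2.1
    fold_u := ?_
    fold_p := ?_
    fold_q := ?_
    fold_t := ?_ }⟩ <;> intro c hc d hd hcd
  · exact (h c hc).2.2.2.2.2.2.1.trans (hcd ▸ (h d hd).2.2.2.2.2.2.1.symm)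
  · exact (h c hc).2.2.2.2.2.2.2.1.trans (hcd ▸ (h d hd).2.2.2.2.2.2.2.1.symm)
  · exact (h c hc).2.2.2.2.2.2.2.2.1.trans (hcd ▸ (h d hd).2.2.2.2.2.2.2.2.1.symm)
  · exact (h c hc).2.2.2.2.2.2.2.2.2.trans (hcd ▸ (h d hd).2.2.2.2.2.2.2.2.2.symm)

namespace Anchoring

variable (Φ : Anchoring G)

theorem mk_p : PicksFrom G.nontrivialComponents Φ.p := fun c hc =>
  (connectedComponentMk_eq_of_adj (Φ.adj_u_p c hc)).symm.trans (Φ.mk_u c hc)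

theorem mk_q : PicksFrom G.nontrivialComponents Φ.q := fun c hc =>
  (connectedComponentMk_eq_of_adj (Φ.adj_u_q c hc)).symm.trans (Φ.mk_u c hc)

theorem mk_t : PicksFrom G.nontrivialComponents Φ.t := fun c hc =>
  (connectedComponentMk_eq_of_adj (Φ.adj_p_t c hc)).symm.trans (Φ.mk_p c hc)

/-- The nontrivial components in which `p` is not a leaf. -/
def branching : Set G.ConnectedComponent := {c | c ∈ G.nontrivialComponents ∧ Φ.t c ≠ Φ.u c}

/-- The edges from `u` to `p`. -/
def first : Set G.edgeSet := edgeFamily G.nontrivialComponents Φ.u Φ.p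

/-- The edges from `p` to `t`, in components in which `p` is not a leaf. -/
def second : Set G.edgeSet := edgeFamily Φ.branching Φ.p Φ.t

/-- The edges from `u` to `q`. -/
def marked : Set G.edgeSet := edgeFamily G.nontrivialComponents Φ.u Φ.q

/-- A setoid on the edges is compatible if each of `first` and `second` lies in a single class and
if unmarked edges that correspond in isomorphic components are related. -/
def Compatible (R : Setoid G.edgeSet) : Prop :=
  (∀ x ∈ Φ.first, ∀ y ∈ Φ.first, R x y) ∧ (∀ x ∈ Φ.second, ∀ y ∈ Φ.second, R x y) ∧
    ∀ x ∉ Φ.marked, ∀ y ∉ Φ.marked, x.1.map Φ.fold = y.1.map Φ.fold → R x y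

/-- A setoid on the edges is separating if it does not relate the marked edges of two distinct
isomorphic components. -/
def Separating (R : Setoid G.edgeSet) : Prop :=
  ∀ c (hc : c ∈ G.nontrivialComponents) d (hd : d ∈ G.nontrivialComponents),
    Φ.type c = Φ.type d →
      R ⟨s(Φ.u c, Φ.q c), Φ.adj_u_q c hc⟩ ⟨s(Φ.u d, Φ.q d), Φ.adj_u_q d hd⟩ → c = d

variable {Φ}

theorem Compatible.mono {R S : Setoid G.edgeSet} (h : R ≤ S) (hR : Φ.Compatible R) :
    Φ.Compatible S :=
  ⟨fun x hx y hy => h (hR.1 x hx y hy), fun x hx y hy => h (hR.2.1 x hx y hy),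
    fun x hx y hy hxy => h (hR.2.2 x hx y hy hxy)⟩

variable (Φ)

theorem mem_first_of_fold_eq {x y : G.edgeSet} (hx : x ∈ Φ.first)
    (h : x.1.map Φ.fold = y.1.map Φ.fold) : y ∈ Φ.first :=
  ComponentFolding.mem_edgeFamily_of_fold_eq (fun _ _ _ h _ => h) Φ.mk_u Φ.mk_p Φ.adj_u_p
    Φ.fold_u Φ.fold_p hx h

theorem mem_marked_of_fold_eq {x y : G.edgeSet} (hx : x ∈ Φ.marked)
    (h : x.1.map Φ.fold = y.1.map Φ.fold) : y ∈ Φ.marked :=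
  ComponentFolding.mem_edgeFamily_of_fold_eq (fun _ _ _ h _ => h) Φ.mk_u Φ.mk_q Φ.adj_u_q
    Φ.fold_u Φ.fold_q hx h

theorem mem_second_of_fold_eq {x y : G.edgeSet} (hx : x ∈ Φ.second)
    (h : x.1.map Φ.fold = y.1.map Φ.fold) : y ∈ Φ.second := by
  refine ComponentFolding.mem_edgeFamily_of_fold_eq ?_ (fun c hc => Φ.mk_p c hc.1)
    (fun c hc => Φ.mk_t c hc.1) (fun c hc => Φ.adj_p_t c hc.1)
    (fun c hc d hd => Φ.fold_p c hc.1 d hd.1) (fun c hc d hd => Φ.fold_t c hc.1 d hd.1) hx h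
  intro c hc d hd hcd
  refine ⟨hd, fun heq => hc.2 (Φ.fold_inj ?_ ?_)⟩
  · rw [Φ.mk_t c hc.1, Φ.mk_u c hc.1]
  · rw [Φ.fold_t c hc.1 d hd hcd, Φ.fold_u c hc.1 d hd hcd, heq]

theorem marked_notMem_first {x : G.edgeSet} (hx : x ∈ Φ.marked) : x ∉ Φ.first := by
  obtain ⟨⟨a, b⟩, hab⟩ := x
  intro hx'
  obtain ⟨hc, h⟩ := mk_eq_of_mem_edgeFamily Φ.mk_u Φ.mk_q hx
  obtain ⟨-, h'⟩ := mk_eq_of_mem_edgeFamily Φ.mk_u Φ.mk_p hx'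
  exact Φ.p_ne_q _ hc (Sym2.congr_right.1 (h'.symm.trans h))

theorem marked_notMem_second {x : G.edgeSet} (hx : x ∈ Φ.marked) : x ∉ Φ.second := by
  obtain ⟨⟨a, b⟩, hab⟩ := x
  intro hx'
  obtain ⟨hc, h⟩ := mk_eq_of_mem_edgeFamily Φ.mk_u Φ.mk_q hx
  obtain ⟨hb, h'⟩ := mk_eq_of_mem_edgeFamily (fun c hc => Φ.mk_p c hc.1)
    (fun c hc => Φ.mk_t c hc.1) hx'
  rcases Sym2.eq_iff.1 (h.symm.trans h') with ⟨h1, -⟩ | ⟨h1, -⟩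
  · exact (Φ.adj_u_p _ hc).ne h1
  · exact hb.2 h1.symm

theorem first_notMem_second {x : G.edgeSet} (hx : x ∈ Φ.first) : x ∉ Φ.second := by
  obtain ⟨⟨a, b⟩, hab⟩ := x
  intro hx'
  obtain ⟨hc, h⟩ := mk_eq_of_mem_edgeFamily Φ.mk_u Φ.mk_p hx
  obtain ⟨hb, h'⟩ := mk_eq_of_mem_edgeFamily (fun c hc => Φ.mk_p c hc.1)
    (fun c hc => Φ.mk_t c hc.1) hx'
  rcases Sym2.eq_iff.1 (h.symm.trans h') with ⟨h1, -⟩ | ⟨h1, -⟩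
  · exact (Φ.adj_u_p _ hc).ne h1
  · exact hb.2 h1.symm

open Classical in
/-- The labelling of edges whose fibres are the classes of the finest compatible setoid. -/
noncomputable def label (x : G.edgeSet) : Prop × Prop × Prop × Option (Sym2 V) :=
  (x ∈ Φ.first, x ∈ Φ.second, x ∈ Φ.marked,
    if x ∈ Φ.first ∨ x ∈ Φ.second then none
    else if x ∈ Φ.marked then some x.1 else some (x.1.map Φ.fold))

theorem label_eq_iff {x y : G.edgeSet} : Φ.label x = Φ.label y ↔
    (x ∈ Φ.first ↔ y ∈ Φ.first) ∧ (x ∈ Φ.second ↔ y ∈ Φ.second) ∧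
      (x ∈ Φ.marked ↔ y ∈ Φ.marked) ∧ (x ∉ Φ.first → x ∉ Φ.second →
        (x ∈ Φ.marked → x.1 = y.1) ∧ (x ∉ Φ.marked → x.1.map Φ.fold = y.1.map Φ.fold)) := by
  simp only [label, Prod.mk.injEq, eq_iff_iff]
  refine and_congr_right fun h1 => and_congr_right fun h2 => and_congr_right fun h3 => ?_
  by_cases hy1 : y ∈ Φ.first <;> by_cases hy2 : y ∈ Φ.second <;> by_cases hy3 : y ∈ Φ.marked <;>
    simp [h1, h2, h3, hy1, hy2, hy3]

theorem compatible_label : Φ.Compatible (Setoid.ker Φ.label) := by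
  refine ⟨fun x hx y hy => ?_, fun x hx y hy => ?_, fun x hx y hy h => ?_⟩ <;>
    rw [Setoid.ker_def, label_eq_iff]
  · exact ⟨iff_of_true hx hy,
      iff_of_false (Φ.first_notMem_second hx) (Φ.first_notMem_second hy),
      iff_of_false (fun h => Φ.marked_notMem_first h hx) (fun h => Φ.marked_notMem_first h hy),
      fun h => (h hx).elim⟩
  · exact ⟨iff_of_false (fun h => Φ.first_notMem_second h hx)
        (fun h => Φ.first_notMem_second h hy), iff_of_true hx hy,
      iff_of_false (fun h => Φ.marked_notMem_second h hx) (fun h => Φ.marked_notMem_second h hy),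
      fun _ h => (h hx).elim⟩
  · exact ⟨⟨fun hx => Φ.mem_first_of_fold_eq hx h, fun hx => Φ.mem_first_of_fold_eq hx h.symm⟩,
      ⟨fun hx => Φ.mem_second_of_fold_eq hx h, fun hx => Φ.mem_second_of_fold_eq hx h.symm⟩,
      iff_of_false hx hy, fun _ _ => ⟨fun h => (hx h).elim, fun _ => h⟩⟩

theorem separating_label : Φ.Separating (Setoid.ker Φ.label) := by
  intro c hc d hd _ h
  rw [Setoid.ker_def, label_eq_iff] at h
  have hmem : (⟨s(Φ.u c, Φ.q c), Φ.adj_u_q c hc⟩ : G.edgeSet) ∈ Φ.marked := ⟨c, hc, rfl⟩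
  have heq := (h.2.2.2 (Φ.marked_notMem_first hmem) (Φ.marked_notMem_second hmem)).1 hmem
  rw [← Φ.mk_u c hc, ← Φ.mk_u d hd]
  rcases Sym2.eq_iff.1 heq with ⟨h1, -⟩ | ⟨h1, -⟩
  · rw [h1]
  · rw [h1, Φ.mk_q d hd, Φ.mk_u d hd]

theorem properSetoid_label : ProperSetoid (Setoid.ker Φ.label) := by
  intro a b d hb hd h
  rw [Setoid.ker_def, label_eq_iff] at h
  obtain ⟨h1, h2, h3, h4⟩ := h
  by_cases hx1 : ⟨s(a, b), hb⟩ ∈ Φ.first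
  · exact Sym2.congr_right.1 ((mk_eq_of_mem_edgeFamily Φ.mk_u Φ.mk_p hx1).2.trans
      (mk_eq_of_mem_edgeFamily Φ.mk_u Φ.mk_p (h1.1 hx1)).2.symm)
  by_cases hx2 : ⟨s(a, b), hb⟩ ∈ Φ.second
  · exact Sym2.congr_right.1 ((mk_eq_of_mem_edgeFamily (fun c hc => Φ.mk_p c hc.1)
      (fun c hc => Φ.mk_t c hc.1) hx2).2.trans (mk_eq_of_mem_edgeFamily
        (fun c hc => Φ.mk_p c hc.1) (fun c hc => Φ.mk_t c hc.1) (h2.1 hx2)).2.symm)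
  by_cases hx3 : ⟨s(a, b), hb⟩ ∈ Φ.marked
  · exact Sym2.congr_right.1 ((h4 hx1 hx2).1 hx3)
  · exact Sym2.congr_right.1 (Φ.edge_inj hb hd rfl ((h4 hx1 hx2).2 hx3))

theorem saturatedFor_first_label : SaturatedFor Φ.first (Setoid.ker Φ.label) :=
  fun _ _ h => (Φ.label_eq_iff.1 h).1.1

theorem saturatedFor_second_label : SaturatedFor Φ.second (Setoid.ker Φ.label) :=
  fun _ _ h => (Φ.label_eq_iff.1 h).2.1.1

variable {Φ}

/-- Automorphisms preserving the classes `first` and `second` map anchors to anchors. -/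
theorem map_u {R : Setoid G.edgeSet} (h1 : SaturatedFor Φ.first R)
    (h2 : SaturatedFor Φ.second R) {φ : G ≃g G} (hφ : ∀ e, R (φ.mapEdgeSet e) e)
    {c : G.ConnectedComponent} (hc : c ∈ G.nontrivialComponents) :
    φ (Φ.u c) = Φ.u (G.connectedComponentMk (φ (Φ.u c))) := by
  have hup := Φ.adj_u_p c hc
  have hpt := Φ.adj_p_t c hc
  have hφup : G.Adj (φ (Φ.u c)) (φ (Φ.p c)) := φ.map_adj_iff.2 hup
  have hφpt : G.Adj (φ (Φ.p c)) (φ (Φ.t c)) := φ.map_adj_iff.2 hpt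
  have hfirst : (⟨s(φ (Φ.u c), φ (Φ.p c)), hφup⟩ : G.edgeSet) ∈ Φ.first :=
    h1 _ _ (R.symm' (hφ ⟨s(Φ.u c, Φ.p c), hup⟩)) ⟨c, hc, rfl⟩
  obtain ⟨hd, heq⟩ := mk_eq_of_mem_edgeFamily Φ.mk_u Φ.mk_p hfirst
  set d := G.connectedComponentMk (φ (Φ.u c)) with hd_def
  rcases Sym2.eq_iff.1 heq with ⟨h, -⟩ | ⟨h, h'⟩
  · exact h
  exfalso
  by_cases ht : Φ.t c = Φ.u c
  · have hleaf : ∀ s, G.Adj (Φ.u d) s → s = Φ.p d := by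
      intro s hs
      rw [← h', ← φ.apply_symm_apply s, φ.map_adj_iff] at hs
      rw [← h, ← Φ.leaf c hc ht _ hs, φ.apply_symm_apply]
    exact Φ.p_ne_q d hd (hleaf _ (Φ.adj_u_q d hd)).symm
  · have hsecond : (⟨s(φ (Φ.p c), φ (Φ.t c)), hφpt⟩ : G.edgeSet) ∈ Φ.second :=
      h2 _ _ (R.symm' (hφ ⟨s(Φ.p c, Φ.t c), hpt⟩)) ⟨c, ⟨hc, ht⟩, rfl⟩
    obtain ⟨hb, heq'⟩ := mk_eq_of_mem_edgeFamily (fun c hc => Φ.mk_p c hc.1)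
      (fun c hc => Φ.mk_t c hc.1) hsecond
    rw [← connectedComponentMk_eq_of_adj hφup, ← hd_def] at hb heq'
    rcases Sym2.eq_iff.1 heq' with ⟨h3, -⟩ | ⟨h3, -⟩
    · exact (Φ.adj_u_p d hd).ne (h'.symm.trans h3)
    · exact hb.2 (h3.symm.trans h')

theorem _root_.SimpleGraph.ProperSetoid.apply_eq_self {R : Setoid G.edgeSet}
    (hR : ProperSetoid R) {φ : G ≃g G} (hφ : ∀ e, R (φ.mapEdgeSet e) e) {x y : V}
    (hx : φ x = x) (hxy : G.Reachable x y) : φ y = y := by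
  obtain ⟨w⟩ := hxy
  induction w with
  | nil => exact hx
  | @cons a b _ hab _ ih =>
    refine ih ?_
    have hab' : G.Adj a (φ b) := by
      rw [← φ.map_adj_iff, hx] at hab
      exact hab
    refine hR hab' hab ?_
    have h := hφ ⟨s(a, b), hab⟩
    have heq : φ.mapEdgeSet ⟨s(a, b), hab⟩ = ⟨s(a, φ b), hab'⟩ :=
      Subtype.ext (congrArg (fun z => s(z, φ b)) hx)
    rwa [heq] at h

/-- A proper compatible separating setoid having `first` and `second` as unions of classes is
distinguishing. -/
theorem distinguishingSetoid_of_separating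
    (hvert : ∀ u v : V, IsolatedVertex G u → IsolatedVertex G v → u = v) {R : Setoid G.edgeSet}
    (hcomp : Φ.Compatible R) (hR : ProperSetoid R) (h1 : SaturatedFor Φ.first R)
    (h2 : SaturatedFor Φ.second R) (hsep : Φ.Separating R) : DistinguishingSetoid R := by
  intro φ hφ x
  by_cases hiso : IsolatedVertex G x
  · refine hvert _ _ (fun z hz => hiso (φ.symm z) ?_) hiso
    rwa [← φ.map_adj_iff, φ.apply_symm_apply]
  obtain ⟨x', hx'⟩ : ∃ x', G.Adj x x' := by simpa [IsolatedVertex] using hiso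
  have hc : G.connectedComponentMk x ∈ G.nontrivialComponents := ⟨x, x', hx', rfl⟩
  set c := G.connectedComponentMk x with hc_def
  suffices hu : φ (Φ.u c) = Φ.u c from
    hR.apply_eq_self hφ hu (ConnectedComponent.exact (Φ.mk_u c hc))
  have hmap := map_u h1 h2 hφ hc
  have huq := Φ.adj_u_q c hc
  have hφuq : G.Adj (φ (Φ.u c)) (φ (Φ.q c)) := φ.map_adj_iff.2 huq
  have hd : G.connectedComponentMk (φ (Φ.u c)) ∈ G.nontrivialComponents := ⟨_, _, hφuq, rfl⟩
  have htype : Φ.type c = Φ.type (G.connectedComponentMk (φ (Φ.u c))) := by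
    rw [Φ.type_iso, Φ.mk_u c hc]
  have hφq : R ⟨s(φ (Φ.u c), φ (Φ.q c)), hφuq⟩ ⟨s(Φ.u c, Φ.q c), huq⟩ :=
    hφ ⟨s(Φ.u c, Φ.q c), huq⟩
  generalize G.connectedComponentMk (φ (Φ.u c)) = d at hmap hd htype
  generalize φ (Φ.q c) = z at hφuq hφq
  generalize φ (Φ.u c) = v at hmap hφuq hφq ⊢
  subst hmap
  by_cases hz : z = Φ.q d
  · subst hz
    rw [hsep d hd c hc htype.symm hφq]
  obtain ⟨y, hyc, hy⟩ : ∃ y, G.connectedComponentMk y = c ∧ Φ.fold y = Φ.fold z := by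
    refine Φ.exists_fold ?_
    rw [Φ.mk_fold, ← connectedComponentMk_eq_of_adj hφuq, Φ.mk_u d hd, htype]
  have hfu := Φ.fold_u c hc d hd htype
  have huy : G.Adj (Φ.u c) y := by
    refine Φ.adj_of_fold ((Φ.mk_u c hc).trans hyc.symm) ?_
    rw [hfu, hy]
    exact Φ.fold_adj hφuq
  have hz' : (⟨s(Φ.u d, z), hφuq⟩ : G.edgeSet) ∉ Φ.marked := by
    intro hmem
    have := (mk_eq_of_mem_edgeFamily Φ.mk_u Φ.mk_q hmem).2
    rw [Φ.mk_u d hd] at this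
    exact hz (Sym2.congr_right.1 this)
  have hfold : s(Φ.fold (Φ.u c), Φ.fold y) = s(Φ.fold (Φ.u d), Φ.fold z) := by rw [hfu, hy]
  have hy' : (⟨s(Φ.u c, y), huy⟩ : G.edgeSet) ∉ Φ.marked := fun hmem =>
    hz' (Φ.mem_marked_of_fold_eq hmem hfold)
  have hyq : y = Φ.q c := hR huy huq (R.trans' (hcomp.2.2 _ hy' _ hz' hfold) hφq)
  exact (hy' ⟨c, hc, congrArg (fun z => s(Φ.u c, z)) hyq⟩).elim

/-- The automorphism exchanging two isomorphic components. -/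
theorem _root_.SimpleGraph.ComponentFolding.exists_swap (Φ : ComponentFolding G)
    {c d : G.ConnectedComponent} (hcd : Φ.type c = Φ.type d) :
    ∃ σ : G ≃g G, (∀ x, Φ.fold (σ x) = Φ.fold x) ∧
      (∀ x, G.connectedComponentMk x = c → G.connectedComponentMk (σ x) = d) ∧
      (∀ x, G.connectedComponentMk x = d → G.connectedComponentMk (σ x) = c) ∧
      ∀ x, G.connectedComponentMk x ≠ c → G.connectedComponentMk x ≠ d → σ x = x := by
  classical
  have htype : ∀ a, Φ.type (Equiv.swap c d a) = Φ.type a := by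
    intro a
    by_cases h1 : a = c
    · rw [h1, Equiv.swap_apply_left, hcd]
    by_cases h2 : a = d
    · rw [h2, Equiv.swap_apply_right, hcd]
    rw [Equiv.swap_apply_of_ne_of_ne h1 h2]
  have hσ : ∀ x, ∃ y, G.connectedComponentMk y = Equiv.swap c d (G.connectedComponentMk x) ∧
      Φ.fold y = Φ.fold x := fun x =>
    Φ.exists_fold (by rw [Φ.mk_fold, htype])
  choose σ hσ_mk hσ_fold using hσ
  have hinv : Function.Involutive σ := by
    intro x
    refine Φ.fold_inj ?_ (by rw [hσ_fold, hσ_fold])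
    rw [hσ_mk, hσ_mk, Equiv.swap_apply_self]
  have hadj : ∀ {x y}, G.Adj x y → G.Adj (σ x) (σ y) := by
    intro x y h
    refine Φ.adj_of_fold ?_ ?_
    · rw [hσ_mk, hσ_mk, connectedComponentMk_eq_of_adj h]
    · rw [hσ_fold, hσ_fold]
      exact Φ.fold_adj h
  refine ⟨⟨hinv.toPerm, ?_⟩, hσ_fold, ?_, ?_, ?_⟩
  · intro x y
    refine ⟨fun h => ?_, hadj⟩
    have := hadj h
    rwa [Function.Involutive.coe_toPerm, hinv, hinv] at this
  · rintro x rfl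
    exact (hσ_mk x).trans (Equiv.swap_apply_left _ _)
  · rintro x rfl
    exact (hσ_mk x).trans (Equiv.swap_apply_right _ _)
  · intro x hc hd
    refine Φ.fold_inj ?_ (hσ_fold x)
    exact (hσ_mk x).trans (Equiv.swap_apply_of_ne_of_ne hc hd)

/-- A compatible distinguishing setoid is separating. -/
theorem separating_of_distinguishingSetoid {R : Setoid G.edgeSet} (hcomp : Φ.Compatible R)
    (hR : DistinguishingSetoid R) : Φ.Separating R := by
  intro c hc d hd hcd hrel
  obtain ⟨σ, hfold, hσc, hσd, hσ⟩ := Φ.exists_swap hcd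
  have hmap : ∀ {a b}, a ∈ G.nontrivialComponents → b ∈ G.nontrivialComponents →
      Φ.type a = Φ.type b → (∀ x, G.connectedComponentMk x = a →
        G.connectedComponentMk (σ x) = b) → σ (Φ.u a) = Φ.u b ∧ σ (Φ.q a) = Φ.q b := by
    intro a b ha hb hab h
    constructor
    · refine Φ.fold_inj ((h _ (Φ.mk_u a ha)).trans (Φ.mk_u b hb).symm) ?_
      rw [hfold, Φ.fold_u a ha b hb hab]
    · refine Φ.fold_inj ((h _ (Φ.mk_q a ha)).trans (Φ.mk_q b hb).symm) ?_
      rw [hfold, Φ.fold_q a ha b hb hab]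
  have hσu : σ (Φ.u c) = Φ.u d := (hmap hc hd hcd hσc).1
  have hpres : ∀ e, R (σ.mapEdgeSet e) e := by
    intro e
    have hfold_e : (σ.mapEdgeSet e).1.map Φ.fold = e.1.map Φ.fold := by
      change (e.1.map σ).map Φ.fold = _
      rw [Sym2.map_map]
      exact congrArg (fun f => e.1.map f) (funext hfold)
    by_cases he : e ∈ Φ.marked
    · obtain ⟨a, ha, hea⟩ := he
      by_cases hac : a = c
      · subst hac
        obtain rfl : e = ⟨s(Φ.u a, Φ.q a), Φ.adj_u_q a ha⟩ := Subtype.ext hea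
        have : σ.mapEdgeSet ⟨s(Φ.u a, Φ.q a), Φ.adj_u_q a ha⟩ =
            ⟨s(Φ.u d, Φ.q d), Φ.adj_u_q d hd⟩ := by
          obtain ⟨h1, h2⟩ := hmap ha hd hcd hσc
          exact Subtype.ext (congrArg₂ (fun x y => s(x, y)) h1 h2)
        rw [this]
        exact R.symm' hrel
      by_cases had : a = d
      · subst had
        obtain rfl : e = ⟨s(Φ.u a, Φ.q a), Φ.adj_u_q a ha⟩ := Subtype.ext hea
        have : σ.mapEdgeSet ⟨s(Φ.u a, Φ.q a), Φ.adj_u_q a ha⟩ =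
            ⟨s(Φ.u c, Φ.q c), Φ.adj_u_q c hc⟩ := by
          obtain ⟨h1, h2⟩ := hmap ha hc hcd.symm hσd
          exact Subtype.ext (congrArg₂ (fun x y => s(x, y)) h1 h2)
        rw [this]
        exact hrel
      · have : σ.mapEdgeSet e = e := by
          refine Subtype.ext ?_
          change e.1.map σ = e.1
          rw [hea, Sym2.map_mk, hσ _ (by rwa [Φ.mk_u a ha]) (by rwa [Φ.mk_u a ha]),
            hσ _ (by rwa [Φ.mk_q a ha]) (by rwa [Φ.mk_q a ha])]
        rw [this]
    · exact hcomp.2.2 _ (fun h => he (Φ.mem_marked_of_fold_eq h hfold_e)) _ he hfold_e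
  rw [← Φ.mk_u c hc, ← Φ.mk_u d hd, ← hσu, hR σ hpres]

/-- Some setoid is maximal among the proper compatible separating ones having `first` and `second`
as unions of classes. -/
theorem exists_maximal_separating (Φ : Anchoring G) :
    ∃ R, Maximal (fun R => Φ.Compatible R ∧ ProperSetoid R ∧ SaturatedFor Φ.first R ∧
      SaturatedFor Φ.second R ∧ Φ.Separating R) R := by
  refine exists_maximal_setoid ⟨Φ.compatible_label, Φ.properSetoid_label,
    Φ.saturatedFor_first_label, Φ.saturatedFor_second_label, Φ.separating_label⟩ ?_
  rintro S U ⟨R₀, hR₀⟩ - hS hU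
  refine ⟨(hS R₀ hR₀).1.mono fun x y h => (hU x y).2 ⟨R₀, hR₀, h⟩, ?_, ?_, ?_, ?_⟩
  · intro a b d hb hd h
    obtain ⟨R, hR, h⟩ := (hU _ _).1 h
    exact (hS R hR).2.1 hb hd h
  · intro x y h
    obtain ⟨R, hR, h⟩ := (hU _ _).1 h
    exact (hS R hR).2.2.1 x y h
  · intro x y h
    obtain ⟨R, hR, h⟩ := (hU _ _).1 h
    exact (hS R hR).2.2.2.1 x y h
  · intro c hc d hd hcd h
    obtain ⟨R, hR, h⟩ := (hU _ _).1 h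
    exact (hS R hR).2.2.2.2 c hc d hd hcd h

end Anchoring

theorem exists_maximal_proper_distinguishing (hedge : ∀ u v : V, ¬ IsolatedEdge G u v)
    (hvert : ∀ u v : V, IsolatedVertex G u → IsolatedVertex G v → u = v) :
    ∃ R : Setoid G.edgeSet, Maximal (fun S => ProperSetoid S ∧ DistinguishingSetoid S) R := by
  obtain ⟨Φ⟩ := nonempty_anchoring hedge
  obtain ⟨R₀, hR₀⟩ := Φ.exists_maximal_separating
  obtain ⟨hcomp, hprop, hsat1, hsat2, hsep⟩ := hR₀.1
  let P : Setoid G.edgeSet → Prop := fun R =>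
    Φ.Compatible R ∧ ProperSetoid R ∧ DistinguishingSetoid R
  have hmax₀ : Maximal (fun R => (P R ∧ SaturatedFor Φ.first R) ∧ SaturatedFor Φ.second R) R₀ :=
    ⟨⟨⟨⟨hcomp, hprop, Anchoring.distinguishingSetoid_of_separating hvert hcomp hprop hsat1 hsat2
      hsep⟩, hsat1⟩, hsat2⟩, fun R hR hle => hR₀.2 ⟨hR.1.1.1, hR.1.1.2.1, hR.1.2, hR.2,
        Anchoring.separating_of_distinguishingSetoid hR.1.1.1 hR.1.1.2.2⟩ hle⟩
  have hP : ∀ {R S T : Setoid G.edgeSet}, P R → R ≤ S → S ≤ T → P T → P S :=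
    fun hR hRS hST hT => ⟨hR.1.mono hRS, ProperSetoid.mono hST hT.2.1, DistinguishingSetoid.mono hST hT.2.2⟩
  obtain ⟨R₁, hle₁, hmax₁⟩ := exists_maximal_of_maximal_saturated
    (fun hR hRS hST hT => ⟨hP hR.1 hRS hST hT.1, SaturatedFor.mono hST hT.2⟩) hmax₀ hcomp.2.1
  obtain ⟨R₂, hle₂, hmax₂⟩ := exists_maximal_of_maximal_saturated hP hmax₁
    fun x hx y hy => hle₁ (hcomp.1 x hx y hy)
  exact ⟨R₂, hmax₂.1.2, fun R hR hle => hmax₂.2 ⟨hmax₂.1.1.mono hle, hR⟩ hle⟩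

end SimpleGraph

/-- every simple graph with no isolated edge and at most one
isolated vertex has an irreducible proper distinguishing edge colouring. -/
theorem stmt11 {V : Type u} (G : SimpleGraph V)
    (hedge : ∀ u v : V, ¬ IsolatedEdge G u v)
    (hvert : ∀ u v : V, IsolatedVertex G u → IsolatedVertex G v → u = v) :
    ∃ (C : Type u) (c : G.edgeSet → C),
      ProperEdgeColoring G c ∧ EdgeDistinguishing G c ∧
        ∀ a b : C, a ≠ b → b ∈ Set.range c →
          ¬ (ProperEdgeColoring G (mergeMap a b ∘ c) ∧
              EdgeDistinguishing G (mergeMap a b ∘ c)) := by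
  obtain ⟨R, hR⟩ := SimpleGraph.exists_maximal_proper_distinguishing hedge hvert
  exact SimpleGraph.exists_irreducible_of_maximal hR
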